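/- arXiv:1708.06143 — 3 statements merged into one kernel-verified Lean document; each statement's English description precedes it below -/
import Mathlib

section
/- Let R be a commutative Noetherian ring. Then the Krull dimension of the power series ring R⟦X⟧ equals one more than the Krull dimension of R: ringKrullDim R⟦X⟧ = ringKrullDim R + 1. -/
theorem powerSeries_X_mem_jacobson (R : Type*) [CommRing R] :
    (PowerSeries.X : PowerSeries R) ∈ Ring.jacobson (PowerSeries R) := by
  rw [← Ideal.jacobson_bot, Ideal.mem_jacobson_bot]
  intro y
  rw [PowerSeries.isUnit_iff_constantCoeff]
  simp

theorem powerSeries_ker_constantCoeff (R : Type*) [CommRing R] :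
    RingHom.ker (PowerSeries.constantCoeff (R := R)) =
      Ideal.span {(PowerSeries.X : PowerSeries R)} := by
  ext f
  rw [RingHom.mem_ker, Ideal.mem_span_singleton, PowerSeries.X_dvd_iff]

/-- For a commutative Noetherian ring `R`, the Krull dimension of the power series ring
`R⟦X⟧` equals one more than the Krull dimension of `R`. -/
theorem ringKrullDim_powerSeries (R : Type*) [CommRing R] [IsNoetherianRing R] :
    ringKrullDim (PowerSeries R) = ringKrullDim R + 1 := by
  apply le_antisymm _ ringKrullDim_succ_le_ringKrullDim_powerseries
  have h := ringKrullDim_le_ringKrullDim_quotient_add_card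
    ({PowerSeries.X} : Finset (PowerSeries R))
    (by simpa using powerSeries_X_mem_jacobson R)
  have hs : Ideal.span ((({PowerSeries.X} : Finset (PowerSeries R))) : Set (PowerSeries R)) =
      RingHom.ker (PowerSeries.constantCoeff (R := R)) := by
    rw [Finset.coe_singleton, powerSeries_ker_constantCoeff]
  have e := ringKrullDim_eq_of_ringEquiv
    ((Ideal.quotEquivOfEq hs).trans
      (RingHom.quotientKerEquivOfSurjective
        (f := PowerSeries.constantCoeff (R := R)) PowerSeries.constantCoeff_surj))
  rw [e] at h
  simpa using h
end

section
/- Let k be a field, n a natural number, and P a prime ideal of the power series ring k⟦X₁,…,Xₙ⟧ in n variables over k. Then the height of P plus the Krull dimension of the quotient ring k⟦X₁,…,Xₙ⟧/P equals n. -/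
namespace MvPSAux


open IsLocalRing MvPowerSeries

theorem maxIdeal_aux {k : Type*} [Field k] (n : ℕ) :
    maximalIdeal (MvPowerSeries (Fin n) k) = Ideal.span (Set.range MvPowerSeries.X) := by
  have key : ∀ (n : ℕ) (f : MvPowerSeries (Fin n) k), MvPowerSeries.constantCoeff f = 0 →
      f ∈ Ideal.span (Set.range (MvPowerSeries.X (R := k) (σ := Fin n))) := by
    intro n
    induction n with
    | zero =>
      intro f hf
      have : f = 0 := (MvPowerSeries.isEmptyEquiv (Fin 0) k).injective (by simpa using hf)
      simp [this]
    | succ n ih =>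
      intro f hf
      set e := MvPowerSeries.finSuccEquiv k n with he
      have h1 : e f = PowerSeries.X * PowerSeries.mk (fun p => PowerSeries.coeff (p + 1) (e f))
          + PowerSeries.C (PowerSeries.constantCoeff (e f)) := PowerSeries.eq_X_mul_shift_add_const _
      have h2 : PowerSeries.constantCoeff (e f) ∈
          Ideal.span (Set.range (MvPowerSeries.X (R := k) (σ := Fin n))) := by
        apply ih
        have := MvPowerSeries.coeff_coeff_finSuccEquiv (R := k) f (k := 0) (x := 0)
        rw [Finsupp.cons_zero_zero] at this
        simpa [he, hf] using this
      have h3 : f = e.symm (e f) := by simp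
      rw [h3, h1, map_add, map_mul]
      refine Ideal.add_mem _ (Ideal.mul_mem_right _ _ ?_) ?_
      · have : e.symm PowerSeries.X = MvPowerSeries.X 0 := by
          rw [AlgEquiv.symm_apply_eq, he, MvPowerSeries.finSuccEquiv_X_zero]
        rw [this]
        exact Ideal.subset_span ⟨0, rfl⟩
      · have := Ideal.mem_map_of_mem (e.symm.toRingEquiv.toRingHom.comp PowerSeries.C) h2
        rw [Ideal.map_span] at this
        refine Ideal.span_mono ?_ this
        rintro _ ⟨_, ⟨j, rfl⟩, rfl⟩
        refine ⟨j.succ, ?_⟩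
        symm
        change e.symm (PowerSeries.C (MvPowerSeries.X j)) = _
        rw [AlgEquiv.symm_apply_eq, he, MvPowerSeries.finSuccEquiv_X_succ]
  apply le_antisymm
  · intro f hf
    apply key
    by_contra h
    exact hf (MvPowerSeries.isUnit_iff_constantCoeff.mpr (Ne.isUnit h))
  · rw [Ideal.span_le]
    rintro _ ⟨i, rfl⟩
    change ¬ IsUnit _
    rw [MvPowerSeries.isUnit_iff_constantCoeff]
    simp

theorem complete_aux {k : Type*} [Field k] (n : ℕ) :
    IsAdicComplete (maximalIdeal (MvPowerSeries (Fin n) k)) (MvPowerSeries (Fin n) k) := by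
  rw [maxIdeal_aux]; infer_instance

theorem dim_aux {k : Type*} [Field k] (n : ℕ) :
    ringKrullDim (MvPowerSeries (Fin n) k) ≤ n := by
  refine (ringKrullDim_le_spanFinrank_maximalIdeal _).trans ?_
  rw [maxIdeal_aux]
  have := Submodule.spanFinrank_span_le_ncard_of_finite (R := MvPowerSeries (Fin n) k)
    (Set.finite_range (MvPowerSeries.X (R := k) (σ := Fin n)))
  have h2 : (Set.range (MvPowerSeries.X (R := k) (σ := Fin n))).ncard ≤ n := by
    rw [← Set.image_univ]
    refine (Set.ncard_image_le Set.finite_univ).trans ?_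
    simp [Set.ncard_univ]
  exact_mod_cast this.trans h2

theorem dim_integral_aux {A B : Type*} [CommRing A] [CommRing B] [Algebra A B]
    [Algebra.IsIntegral A B] (hinj : Function.Injective (algebraMap A B)) :
    ringKrullDim A ≤ ringKrullDim B := by
  refine iSup_le fun l => ?_
  obtain ⟨Q, -, hQ, hQc⟩ := Ideal.exists_ideal_over_prime_of_isIntegral l.head.asIdeal (⊥ : Ideal B)
    (by rw [← RingHom.ker_eq_comap_bot, (RingHom.injective_iff_ker_eq_bot _).mp hinj]; exact bot_le)
  have : Q.LiesOver l.head.asIdeal := ⟨hQc.symm⟩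
  obtain ⟨M, hM, -⟩ := Ideal.exists_ltSeries_of_hasGoingUp l Q
  rw [← hM]
  exact le_iSup (fun p : LTSeries (PrimeSpectrum B) => ((p.length : ℕ∞) : WithBot ℕ∞)) M

theorem upper_aux {R : Type*} [CommRing R] (P : PrimeSpectrum R) :
    (Order.height P : WithBot ℕ∞) + ringKrullDim (R ⧸ P.asIdeal) ≤ ringKrullDim R := by
  have : Nonempty (PrimeSpectrum R) := ⟨P⟩
  have h : ringKrullDim (R ⧸ P.asIdeal) = Order.coheight P := by
    rw [ringKrullDim_quotient, Order.coheight_eq_krullDim_Ici]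
    rfl
  rw [h, ringKrullDim, Order.krullDim_eq_iSup_height_add_coheight_of_nonempty]
  exact_mod_cast le_iSup (fun a : PrimeSpectrum R => Order.height a + Order.coheight a) P

/-- extension of a prime to power series -/
noncomputable def extAux {A : Type*} [CommRing A] (q : PrimeSpectrum A) :
    PrimeSpectrum (PowerSeries A) :=
  ⟨RingHom.ker (PowerSeries.map (Ideal.Quotient.mk q.asIdeal)), RingHom.ker_isPrime _⟩

theorem mem_extAux {A : Type*} [CommRing A] (q : PrimeSpectrum A) (f : PowerSeries A) :
    f ∈ (extAux q).asIdeal ↔ ∀ i, PowerSeries.coeff i f ∈ q.asIdeal := by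
  simp only [extAux, RingHom.mem_ker, PowerSeries.ext_iff, PowerSeries.coeff_map, map_zero,
    Ideal.Quotient.eq_zero_iff_mem]

theorem extAux_strictMono {A : Type*} [CommRing A] : StrictMono (extAux (A := A)) := by
  refine Monotone.strictMono_of_injective ?_ ?_
  · intro p q h f hf
    rw [mem_extAux] at *
    exact fun i => h (hf i)
  · intro p q h
    ext a
    have : ∀ p : PrimeSpectrum A, a ∈ p.asIdeal ↔ PowerSeries.C a ∈ (extAux p).asIdeal := by
      intro p
      rw [mem_extAux]
      refine ⟨fun h i => ?_, fun h => by simpa using h 0⟩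
      rw [PowerSeries.coeff_C]; split_ifs <;> simp [h]
    rw [this, this, h]

theorem step_height {A : Type*} [CommRing A] [IsLocalRing A] [IsNoetherianRing A]
    (P : PrimeSpectrum (PowerSeries A)) (f : PowerSeries A) (hf : f ∈ P.asIdeal)
    (hf0 : f.map (residue A) ≠ 0) :
    Order.height (PrimeSpectrum.comap PowerSeries.C P) + 1 ≤ Order.height P := by
  set p := PrimeSpectrum.comap (PowerSeries.C (R := A)) P
  have hne : ¬ P ≤ extAux p := by
    intro h
    apply hf0
    ext i
    have := (mem_extAux p f).1 (h hf) i
    simpa [residue_eq_zero_iff] using le_maximalIdeal p.isPrime.ne_top this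
  have hle : extAux p ≤ P := by
    intro g hg
    rw [mem_extAux] at hg
    have : g ∈ p.asIdeal.map PowerSeries.C := by
      obtain ⟨m, s, hs⟩ := Submodule.fg_iff_exists_fin_generating_family.mp
        (IsNoetherian.noetherian p.asIdeal)
      have h1 : ∀ i, ∃ c : Fin m → A, ∑ j, c j • s j = PowerSeries.coeff i g := fun i =>
        (Submodule.mem_span_range_iff_exists_fun A).1 (by rw [hs]; exact hg i)
      choose c hc using h1
      have h2 : g = ∑ j, PowerSeries.mk (fun i => c i j) * PowerSeries.C (s j) := by
        ext i
        simp [← hc i]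
      rw [h2]
      refine Ideal.sum_mem _ fun j _ => Ideal.mul_mem_left _ _ (Ideal.mem_map_of_mem _ ?_)
      rw [← hs]
      exact Submodule.subset_span ⟨j, rfl⟩
    exact Ideal.map_le_iff_le_comap.2 le_rfl this
  calc _ ≤ Order.height (extAux p) + 1 := by
        gcongr; exact Order.height_le_height_apply_of_strictMono _ extAux_strictMono p
    _ ≤ _ := Order.height_add_one_le (lt_of_le_not_ge hle hne)

theorem step_dim {A : Type*} [CommRing A] [IsLocalRing A]
    [IsAdicComplete (maximalIdeal A) A]
    (P : Ideal (PowerSeries A)) (f : PowerSeries A) (hf : f ∈ P)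
    (hf0 : f.map (residue A) ≠ 0) :
    ringKrullDim (A ⧸ P.comap PowerSeries.C) ≤ ringKrullDim (PowerSeries A ⧸ P) := by
  obtain ⟨g, h, H⟩ := f.exists_isWeierstrassFactorization hf0
  have : Module.Finite A (Polynomial A ⧸ Ideal.span {g}) := H.isDistinguishedAt.monic.finite_quotient
  have : Module.Finite A (PowerSeries A ⧸ Ideal.span {f}) :=
    Module.Finite.equiv H.algEquivQuotient.toLinearEquiv
  have hle : Ideal.span {f} ≤ P := by simpa [Ideal.span_le] using hf
  have : Module.Finite A (PowerSeries A ⧸ P) :=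
    Module.Finite.of_surjective (Ideal.Quotient.factorₐ A hle).toLinearMap
      (Ideal.Quotient.factor_surjective hle)
  have hint : Algebra.IsIntegral A (PowerSeries A ⧸ P) := inferInstance
  let φ : A ⧸ P.comap (PowerSeries.C (R := A)) →+* PowerSeries A ⧸ P :=
    Ideal.quotientMap P PowerSeries.C le_rfl
  let := φ.toAlgebra
  have : IsScalarTower A (A ⧸ P.comap (PowerSeries.C (R := A))) (PowerSeries A ⧸ P) :=
    IsScalarTower.of_algebraMap_eq fun x => rfl
  have : Algebra.IsIntegral (A ⧸ P.comap (PowerSeries.C (R := A))) (PowerSeries A ⧸ P) :=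
    Algebra.IsIntegral.tower_top A
  exact dim_integral_aux Ideal.quotientMap_injective


theorem weights_aux {n : ℕ} (S : Set (Fin n → ℕ)) (hS : S.Nonempty) :
    ∃ (e : Fin n → ℕ) (d : Fin n → ℕ), (∀ i, e i ≠ 0) ∧ (∀ i, i.val = 0 → e i = 1) ∧ d ∈ S ∧
      ∀ d' ∈ S, d' ≠ d → ∑ i, e i * d i < ∑ i, e i * d' i := by
  induction n with
  | zero =>
    obtain ⟨d, hd⟩ := hS
    exact ⟨fun _ => 1, d, by simp, by simp, hd, fun d' _ h => (h (Subsingleton.elim _ _)).elim⟩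
  | succ n ih =>
    classical
    have hT : ((fun d : Fin (n+1) → ℕ => d (Fin.last n)) '' S).Nonempty := hS.image _
    obtain ⟨d₀, hd₀, hm⟩ := Nat.sInf_mem hT
    set m := sInf ((fun d : Fin (n+1) → ℕ => d (Fin.last n)) '' S) with hmdef
    have hmin : ∀ d ∈ S, m ≤ d (Fin.last n) := fun d hd => Nat.sInf_le ⟨d, hd, rfl⟩
    obtain ⟨e, d, he0, he1, hd, hlt⟩ := ih {d | Fin.snoc (α := fun _ => ℕ) d m ∈ S}
      ⟨Fin.init d₀, by
        have : Fin.snoc (α := fun _ => ℕ) (Fin.init d₀) m = d₀ := by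
          rw [← hm]; exact Fin.snoc_init_self d₀
        simpa [this] using hd₀⟩
    refine ⟨Fin.snoc (α := fun _ => ℕ) e (1 + ∑ i, e i * d i), Fin.snoc (α := fun _ => ℕ) d m,
      ?_, ?_, hd, ?_⟩
    · intro i
      refine Fin.lastCases ?_ (fun i => ?_) i
      · simp
      · simpa using he0 i
    · intro i
      refine Fin.lastCases ?_ (fun i => ?_) i
      · intro h
        have : n = 0 := by simpa using h
        subst this
        rw [Fin.snoc_last]
        simp
      · intro h
        simpa using he1 i (by simpa using h)
    · intro d' hd' hne
      simp only [Fin.sum_univ_castSucc, Fin.snoc_castSucc, Fin.snoc_last]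
      rcases (hmin d' hd').eq_or_lt with h | h
      · have h1 : Fin.snoc (α := fun _ => ℕ) (Fin.init d') m = d' := by
          rw [h]; exact Fin.snoc_init_self d'
        have h2 := hlt (Fin.init d') (by simpa [h1] using hd') (by
          intro h3; apply hne; rw [← h1, h3])
        rw [← h]
        exact Nat.add_lt_add_right h2 _
      · have : (1 + ∑ i, e i * d i) * (m + 1) ≤ (1 + ∑ i, e i * d i) * d' (Fin.last n) :=
          Nat.mul_le_mul_left _ h
        rw [mul_add] at this
        omega

theorem exists_aut {k : Type*} [Field k] {n : ℕ} (f : MvPowerSeries (Fin (n+1)) k) (hf : f ≠ 0) :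
    ∃ σ : MvPowerSeries (Fin (n+1)) k ≃+* MvPowerSeries (Fin (n+1)) k,
      PowerSeries.map (constantCoeff (σ := Fin n) (R := k)) (finSuccEquiv k n (σ f)) ≠ 0 := by
  obtain ⟨e, d, he0, he1, hd, hde⟩ := weights_aux (n := n + 1)
    {d | coeff (Finsupp.equivFunOnFinite.symm d) f ≠ 0} (by
      by_contra h
      rw [Set.not_nonempty_iff_eq_empty, Set.eq_empty_iff_forall_notMem] at h
      apply hf
      ext d
      simpa using h (Finsupp.equivFunOnFinite d))
  let a : Fin (n+1) → MvPowerSeries (Fin (n+1)) k := fun i =>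
    if i = 0 then X 0 else X i + X 0 ^ e i
  let b : Fin (n+1) → MvPowerSeries (Fin (n+1)) k := fun i =>
    if i = 0 then X 0 else X i - X 0 ^ e i
  have ha : HasSubst a := hasSubst_of_constantCoeff_zero fun i => by
    by_cases h : i = 0 <;> simp [a, h, he0]
  have hb : HasSubst b := hasSubst_of_constantCoeff_zero fun i => by
    by_cases h : i = 0 <;> simp [b, h, he0]
  have hab : ∀ f : MvPowerSeries (Fin (n+1)) k, subst b (subst a f) = f := by
    intro f
    rw [subst_comp_subst_apply ha hb]
    have : (fun s => subst b (a s)) = (X : Fin (n+1) → MvPowerSeries (Fin (n+1)) k) := by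
      funext i
      by_cases h : i = 0
      · simp [a, h, subst_X hb]; simp [b]
      · simp only [a, h, if_false, subst_add hb, subst_pow hb, subst_X hb]; simp [b, h]
    rw [this, subst_self]; rfl
  have hba : ∀ f : MvPowerSeries (Fin (n+1)) k, subst a (subst b f) = f := by
    intro f
    rw [subst_comp_subst_apply hb ha]
    have : (fun s => subst a (b s)) = (X : Fin (n+1) → MvPowerSeries (Fin (n+1)) k) := by
      funext i
      by_cases h : i = 0
      · simp [b, h, subst_X ha]; simp [a]
      · simp only [b, h, if_false, subst_sub ha, subst_pow ha, subst_X ha]; simp [a, h]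
    rw [this, subst_self]; rfl
  let σ : MvPowerSeries (Fin (n+1)) k ≃+* MvPowerSeries (Fin (n+1)) k :=
    RingEquiv.ofRingHom (substAlgHom (R := k) ha).toRingHom (substAlgHom (R := k) hb).toRingHom
      (by ext1 g; simpa [substAlgHom_apply] using hba g)
      (by ext1 g; simpa [substAlgHom_apply] using hab g)
  have hσ : ∀ g, σ g = subst a g := fun g => substAlgHom_apply ha g
  let ev : MvPowerSeries (Fin (n+1)) k →+* PowerSeries k :=
    (PowerSeries.map (constantCoeff (σ := Fin n) (R := k))).comp
      (finSuccEquiv k n).toRingEquiv.toRingHom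
  have hev : ∀ g N, PowerSeries.coeff N (ev g) = coeff (Finsupp.cons N 0) g := by
    intro g N
    rw [← coeff_coeff_finSuccEquiv]
    simp [ev]
  have heva : ∀ i, ev (a i) = PowerSeries.X ^ e i := by
    intro i
    have h0 : ev (X 0) = PowerSeries.X := by simp [ev]
    by_cases h : i = 0
    · subst h
      simp [a, h0, he1 0 rfl]
    · obtain ⟨j, rfl⟩ := Fin.exists_succ_eq.mpr h
      have : ev (X j.succ) = 0 := by simp [ev]
      simp [a, h0, this, map_add, map_pow]
  have hprod : ∀ (N : ℕ) (d : Fin (n+1) →₀ ℕ),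
      coeff (Finsupp.cons N 0) (d.prod fun s t => (a s) ^ t) =
        if N = ∑ i, e i * d i then 1 else 0 := by
    intro N d
    rw [← hev, Finsupp.prod_fintype _ _ (by simp), map_prod]
    simp only [map_pow, heva, ← pow_mul]
    rw [Finset.prod_pow_eq_pow_sum, PowerSeries.coeff_X_pow]
  refine ⟨σ, fun h0 => hd ?_⟩
  have h1 : PowerSeries.coeff (∑ i, e i * d i) (ev (σ f)) = 0 := by
    have h2 : ev (σ f) = 0 := h0
    rw [h2]; simp
  rw [hev, hσ, coeff_subst ha, finsum_eq_single _ (Finsupp.equivFunOnFinite.symm d)] at h1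
  · rw [hprod] at h1
    simpa using h1
  · intro d' hd'
    rw [hprod]
    split_ifs with hN
    · rw [smul_eq_mul, mul_one]
      by_contra hc
      apply hd'
      by_contra hne
      refine (hde (Finsupp.equivFunOnFinite d') (by simpa using hc) (fun h => hne ?_)).ne
        (by simpa using hN)
      simp [← h]
    · simp

theorem lower_aux {k : Type*} [Field k] (n : ℕ) (P : PrimeSpectrum (MvPowerSeries (Fin n) k)) :
    (n : WithBot ℕ∞) ≤ (Order.height P : WithBot ℕ∞)
      + ringKrullDim (MvPowerSeries (Fin n) k ⧸ P.asIdeal) := by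
  induction n with
  | zero =>
    have : Nontrivial (MvPowerSeries (Fin 0) k ⧸ P.asIdeal) :=
      Ideal.Quotient.nontrivial_iff.mpr P.isPrime.ne_top
    have h1 : (0 : WithBot ℕ∞) ≤ ringKrullDim (MvPowerSeries (Fin 0) k ⧸ P.asIdeal) :=
      ringKrullDim_nonneg_of_nontrivial
    have h2 : (0 : WithBot ℕ∞) ≤ (Order.height P : WithBot ℕ∞) := by exact_mod_cast zero_le
    simpa using add_nonneg h2 h1
  | succ n ih =>
    by_cases hP : P.asIdeal = ⊥
    · have h0 : (n : WithBot ℕ∞) ≤ ringKrullDim (MvPowerSeries (Fin n) k) := by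
        have h1 := ih ⟨⊥, Ideal.isPrime_bot⟩
        exact h1.trans (upper_aux _)
      have h1 : ((n + 1 : ℕ) : WithBot ℕ∞) ≤
          ringKrullDim (MvPowerSeries (Fin (n + 1)) k ⧸ P.asIdeal) := by
        rw [hP, ringKrullDim_eq_of_ringEquiv (RingEquiv.quotientBot _),
          ringKrullDim_eq_of_ringEquiv (finSuccEquiv k n).toRingEquiv]
        refine le_trans ?_ ringKrullDim_succ_le_ringKrullDim_powerseries
        push_cast
        gcongr
      have h2 : (0 : WithBot ℕ∞) ≤ (Order.height P : WithBot ℕ∞) := by exact_mod_cast zero_le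
      simpa using add_le_add h2 h1
    · obtain ⟨f, hf, hf0⟩ := Submodule.exists_mem_ne_zero_of_ne_bot hP
      obtain ⟨σ, hσ⟩ := exists_aut f hf0
      let τ : MvPowerSeries (Fin (n + 1)) k ≃+* PowerSeries (MvPowerSeries (Fin n) k) :=
        σ.trans (finSuccEquiv k n).toRingEquiv
      let Q : PrimeSpectrum (PowerSeries (MvPowerSeries (Fin n) k)) :=
        PrimeSpectrum.comap (τ.symm : _ →+* _) P
      have hQ : τ f ∈ Q.asIdeal := by
        change τ.symm (τ f) ∈ P.asIdeal
        simpa using hf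
      have hres : PowerSeries.map (residue (MvPowerSeries (Fin n) k)) (τ f) ≠ 0 := by
        intro h
        apply hσ
        ext i
        have h1 := congrArg (PowerSeries.coeff i) h
        rw [PowerSeries.coeff_map, map_zero, residue_eq_zero_iff, mem_maximalIdeal, mem_nonunits_iff,
          MvPowerSeries.isUnit_iff_constantCoeff, isUnit_iff_ne_zero, not_not] at h1
        rw [PowerSeries.coeff_map, map_zero]
        exact h1
      have := complete_aux (k := k) n
      have s1 := step_height Q (τ f) hQ hres
      have s2 := step_dim Q.asIdeal (τ f) hQ hres
      have s3 := ih (PrimeSpectrum.comap PowerSeries.C Q)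
      have hh : Order.height Q = Order.height P :=
        Order.height_orderIso (PrimeSpectrum.comapEquiv τ) P
      have hd : ringKrullDim (PowerSeries (MvPowerSeries (Fin n) k) ⧸ Q.asIdeal) =
          ringKrullDim (MvPowerSeries (Fin (n + 1)) k ⧸ P.asIdeal) := by
        refine ringKrullDim_eq_of_ringEquiv (Ideal.quotientEquiv _ _ τ.symm ?_)
        exact (Ideal.map_comap_of_surjective _ τ.symm.surjective _).symm
      rw [← hh, ← hd]
      have s1' : (Order.height (PrimeSpectrum.comap PowerSeries.C Q) : WithBot ℕ∞) + 1 ≤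
        (Order.height Q : WithBot ℕ∞) := by exact_mod_cast s1
      calc ((n + 1 : ℕ) : WithBot ℕ∞) = n + 1 := by push_cast; rfl
        _ ≤ _ := add_le_add_left s3 1
        _ = ((Order.height (PrimeSpectrum.comap PowerSeries.C Q) : WithBot ℕ∞) + 1) +
          ringKrullDim (MvPowerSeries (Fin n) k ⧸ (PrimeSpectrum.comap PowerSeries.C Q).asIdeal) :=
            add_right_comm _ _ _
        _ ≤ _ := add_le_add s1' s2

end MvPSAux

/-- For a field `k`, a natural number `n`, and a prime ideal `P` of the power series ring
`k⟦X₁,…,Xₙ⟧ = MvPowerSeries (Fin n) k` in `n` variables, the height of `P` plus the Krull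
dimension of the quotient ring `k⟦X₁,…,Xₙ⟧/P` equals `n`. (The height of `P` is the height
of the corresponding point of the prime spectrum, i.e. the supremum of lengths of chains of
primes descending from `P`.) -/
theorem height_add_krullDim_quotient_mvPowerSeries {k : Type*} [Field k] (n : ℕ)
    (P : Ideal (MvPowerSeries (Fin n) k)) (hP : P.IsPrime) :
    (Order.height (⟨P, hP⟩ : PrimeSpectrum (MvPowerSeries (Fin n) k)) : WithBot ℕ∞)
      + @id (WithBot ℕ∞) (ringKrullDim (MvPowerSeries (Fin n) k ⧸ P)) = (n : WithBot ℕ∞) := by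
  exact le_antisymm ((MvPSAux.upper_aux ⟨P, hP⟩).trans (MvPSAux.dim_aux n))
    (MvPSAux.lower_aux n ⟨P, hP⟩)
end

section
/- Let k be a field, n a natural number, and let P < Q be adjacent prime ideals of the power series ring k⟦X₁,…,Xₙ⟧ in n variables over k (i.e. there is no prime ideal strictly between P and Q). Then the height of Q equals the height of P plus one. -/
theorem exists_weight (n : ℕ) : ∀ (S : Set (Fin n → ℕ)), S.Nonempty →
    ∃ w : Fin n → ℕ, (∀ i, 0 < w i) ∧ (∀ i : Fin n, (i : ℕ) = 0 → w i = 1) ∧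
      ∃ b ∈ S, ∀ d ∈ S, d ≠ b → ∑ i, w i * b i < ∑ i, w i * d i := by
  induction n with
  | zero =>
    rintro S ⟨b, hb⟩
    exact ⟨fun _ => 1, fun i => i.elim0, fun i => i.elim0, b, hb,
      fun d _ hdb => (hdb (Subsingleton.elim _ _)).elim⟩
  | succ n ih =>
    intro S hS
    classical
    have hex : ∃ c, ∃ d ∈ S, d (Fin.last n) = c := by
      obtain ⟨d, hd⟩ := hS
      exact ⟨_, d, hd, rfl⟩
    set c := Nat.find hex with hc
    obtain ⟨w, hw, hw0, b, ⟨b', hb'S, hb'c, hb'b⟩, hmin⟩ :=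
      ih {e | ∃ d ∈ S, d (Fin.last n) = c ∧ (fun i : Fin n => d i.castSucc) = e} (by
        obtain ⟨d, hd, hdc⟩ := Nat.find_spec hex
        exact ⟨_, d, hd, hdc, rfl⟩)
    refine ⟨Fin.snoc w (∑ i, w i * b i + 1), ?_, ?_, b', hb'S, ?_⟩
    · intro i
      refine Fin.lastCases ?_ (fun i => ?_) i
      · simp
      · simpa using hw i
    · intro i
      refine Fin.lastCases ?_ (fun i => ?_) i
      · intro h
        have : n = 0 := by simpa using h
        subst this
        rw [Fin.snoc_last]
        simp
      · simpa using hw0 i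
    · intro d hd hdb
      rw [Fin.sum_univ_castSucc, Fin.sum_univ_castSucc]
      simp only [Fin.snoc_castSucc, Fin.snoc_last]
      have hbb : ∀ i : Fin n, b' i.castSucc = b i := fun i => congrFun hb'b i
      simp only [hbb, hb'c]
      have hle : c ≤ d (Fin.last n) := Nat.find_min' hex ⟨d, hd, rfl⟩
      rcases hle.eq_or_lt with h | h
      · rw [← h]
        have := hmin (fun i : Fin n => d i.castSucc) ⟨d, hd, h.symm, rfl⟩ (by
          intro h'
          apply hdb
          funext i
          refine Fin.lastCases ?_ (fun i => ?_) i
          · rw [← h, hb'c]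
          · rw [hbb]; exact congrFun h' i)
        simpa using this
      · have : (∑ i, w i * b i + 1) * (c + 1) ≤ (∑ i, w i * b i + 1) * d (Fin.last n) :=
          Nat.mul_le_mul_left _ h
        have h2 : 0 ≤ ∑ i : Fin n, w i * d i.castSucc := Nat.zero_le _
        rw [mul_add, mul_one] at this
        omega

section
variable {k : Type*} [Field k]

theorem mem_maximalIdeal_iff_cc {σ : Type*} (f : MvPowerSeries σ k) :
    f ∈ IsLocalRing.maximalIdeal (MvPowerSeries σ k) ↔ MvPowerSeries.constantCoeff f = 0 := by
  rw [IsLocalRing.mem_maximalIdeal, mem_nonunits_iff, MvPowerSeries.isUnit_iff_constantCoeff,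
    isUnit_iff_ne_zero, not_not]

theorem maximalIdeal_eq_span (n : ℕ) :
    IsLocalRing.maximalIdeal (MvPowerSeries (Fin n) k) =
      Ideal.span (Set.range MvPowerSeries.X) := by
  apply le_antisymm
  · induction n with
    | zero =>
      intro f hf
      rw [mem_maximalIdeal_iff_cc] at hf
      have : f = 0 := by
        ext d
        rw [Subsingleton.elim d 0]
        simpa using hf
      simp [this]
    | succ n ih =>
      intro f hf
      rw [mem_maximalIdeal_iff_cc] at hf
      set e := MvPowerSeries.finSuccEquiv k n
      obtain ⟨g, hg⟩ : PowerSeries.X ∣ e f - PowerSeries.C (PowerSeries.constantCoeff (e f)) := by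
        rw [PowerSeries.X_dvd_iff]; simp
      have h1 : PowerSeries.constantCoeff (e f) ∈
          IsLocalRing.maximalIdeal (MvPowerSeries (Fin n) k) := by
        rw [mem_maximalIdeal_iff_cc, ← PowerSeries.coeff_zero_eq_constantCoeff_apply,
          ← MvPowerSeries.coeff_zero_eq_constantCoeff_apply,
          MvPowerSeries.coeff_coeff_finSuccEquiv]
        simpa using hf
      have h2 := Ideal.mem_map_of_mem ((e.symm.toRingEquiv.toRingHom).comp PowerSeries.C) (ih h1)
      have h3 : f = e.symm (PowerSeries.C (PowerSeries.constantCoeff (e f))) +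
          MvPowerSeries.X 0 * e.symm g := by
        apply e.injective
        rw [map_add, map_mul, e.apply_symm_apply, e.apply_symm_apply,
          MvPowerSeries.finSuccEquiv_X_zero, ← hg]
        ring
      rw [h3]
      refine add_mem ?_ (Ideal.mul_mem_right _ _ (Ideal.subset_span ⟨0, rfl⟩))
      refine (Ideal.map_le_iff_le_comap.2 (Ideal.span_le.2 ?_)) h2
      rintro _ ⟨i, rfl⟩
      refine Ideal.subset_span ⟨i.succ, ?_⟩
      apply e.injective
      simp [e]
  · rw [Ideal.span_le]
    rintro _ ⟨i, rfl⟩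
    rw [SetLike.mem_coe, mem_maximalIdeal_iff_cc]
    simp

instance adicComplete_max (n : ℕ) :
    IsAdicComplete (IsLocalRing.maximalIdeal (MvPowerSeries (Fin n) k))
      (MvPowerSeries (Fin n) k) := by
  rw [maximalIdeal_eq_span]; infer_instance

/-- The elementary automorphism `X i ↦ X i + c i X_0 ^ w i` for `i ≠ 0`. -/
noncomputable def shiftFun {n : ℕ} (c : k) (w : Fin (n+1) → ℕ) (i : Fin (n+1)) :
    MvPowerSeries (Fin (n+1)) k :=
  if i = 0 then MvPowerSeries.X 0 else MvPowerSeries.X i + c • (MvPowerSeries.X 0) ^ w i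

theorem shiftFun_hasSubst {n : ℕ} (c : k) (w : Fin (n+1) → ℕ) (hw : ∀ i, 0 < w i) :
    MvPowerSeries.HasSubst (shiftFun c w) := by
  apply MvPowerSeries.hasSubst_of_constantCoeff_zero
  intro i
  unfold shiftFun
  split_ifs
  · simp
  · simp [(hw i).ne']

theorem shift_comp {n : ℕ} (c : k) (w : Fin (n+1) → ℕ) (hw : ∀ i, 0 < w i)
    (f : MvPowerSeries (Fin (n+1)) k) :
    MvPowerSeries.subst (shiftFun (-c) w) (MvPowerSeries.subst (shiftFun c w) f) = f := by
  have hb := shiftFun_hasSubst (-c) w hw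
  rw [MvPowerSeries.subst_comp_subst_apply (shiftFun_hasSubst c w hw) hb]
  have : (fun s => MvPowerSeries.subst (shiftFun (-c) w) (shiftFun c w s)) = MvPowerSeries.X := by
    funext s
    by_cases hs : s = 0
    · subst hs
      conv_lhs => rw [shiftFun, if_pos rfl, MvPowerSeries.subst_X hb, shiftFun, if_pos rfl]
    · conv_lhs => rw [shiftFun, if_neg hs, MvPowerSeries.subst_add hb, MvPowerSeries.subst_smul hb,
        MvPowerSeries.subst_pow hb, MvPowerSeries.subst_X hb, MvPowerSeries.subst_X hb, shiftFun,
        if_neg hs, shiftFun, if_pos rfl]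
      simp
  rw [this, MvPowerSeries.subst_self]; rfl

/-- The automorphism as a ring equivalence. -/
noncomputable def shiftEquiv {n : ℕ} (w : Fin (n+1) → ℕ) (hw : ∀ i, 0 < w i) :
    MvPowerSeries (Fin (n+1)) k ≃+* MvPowerSeries (Fin (n+1)) k where
  toFun := MvPowerSeries.subst (shiftFun 1 w)
  invFun := MvPowerSeries.subst (shiftFun (-1) w)
  left_inv f := shift_comp 1 w hw f
  right_inv f := by simpa using shift_comp (-1) w hw f
  map_mul' f g := MvPowerSeries.subst_mul (shiftFun_hasSubst 1 w hw) f g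
  map_add' f g := MvPowerSeries.subst_add (shiftFun_hasSubst 1 w hw) f g

theorem exists_equiv_regular (n : ℕ) (f : MvPowerSeries (Fin (n+1)) k) (hf : f ≠ 0) :
    ∃ e : MvPowerSeries (Fin (n+1)) k ≃+* PowerSeries (MvPowerSeries (Fin n) k),
      (e f).map (IsLocalRing.residue (MvPowerSeries (Fin n) k)) ≠ 0 := by
  classical
  obtain ⟨w, hw, hw0, b, hb, hmin⟩ := exists_weight (n+1)
    {d | MvPowerSeries.coeff (Finsupp.equivFunOnFinite.symm d) f ≠ 0} (by
      obtain ⟨d, hd⟩ := (MvPowerSeries.ne_zero_iff_exists_coeff_ne_zero f).1 hf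
      exact ⟨Finsupp.equivFunOnFinite d, by simpa using hd⟩)
  set m := ∑ i, w i * b i with hm
  let ψ : MvPowerSeries (Fin (n+1)) k →+* PowerSeries k :=
    (PowerSeries.map (MvPowerSeries.constantCoeff)).comp
      (MvPowerSeries.finSuccEquiv k n : _ →+* PowerSeries (MvPowerSeries (Fin n) k))
  have hψ : ∀ g, PowerSeries.coeff m (ψ g) = MvPowerSeries.coeff (Finsupp.cons m 0) g := by
    intro g
    simp only [ψ, RingHom.comp_apply, PowerSeries.coeff_map]
    rw [← MvPowerSeries.coeff_zero_eq_constantCoeff_apply]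
    exact MvPowerSeries.coeff_coeff_finSuccEquiv ..
  have hψa : ∀ i, ψ (shiftFun 1 w i) = PowerSeries.X ^ w i := by
    intro i
    by_cases hi : i = 0
    · subst hi
      simp [ψ, shiftFun, hw0 0 rfl]
    · obtain ⟨j, rfl⟩ := Fin.exists_succ_eq.2 hi
      simp [ψ, shiftFun, Fin.succ_ne_zero]
  refine ⟨(shiftEquiv w hw).trans (MvPowerSeries.finSuccEquiv k n).toRingEquiv, fun h0 => ?_⟩
  have h1 := congrArg (PowerSeries.coeff m) h0
  rw [PowerSeries.coeff_map, map_zero, IsLocalRing.residue_eq_zero_iff, mem_maximalIdeal_iff_cc,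
    ← MvPowerSeries.coeff_zero_eq_constantCoeff_apply] at h1
  have h2 : MvPowerSeries.coeff (Finsupp.cons m 0) (MvPowerSeries.subst (shiftFun (1 : k) w) f) = 0 := by
    rw [← h1]
    exact (MvPowerSeries.coeff_coeff_finSuccEquiv ..).symm
  rw [MvPowerSeries.coeff_subst (shiftFun_hasSubst 1 w hw)] at h2
  have h3 : ∀ d : Fin (n+1) →₀ ℕ, MvPowerSeries.coeff (Finsupp.cons m 0)
      (d.prod fun s e => (shiftFun (1 : k) w s) ^ e) = if m = ∑ i, w i * d i then 1 else 0 := by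
    intro d
    rw [← hψ, Finsupp.prod_fintype _ _ (by simp), map_prod]
    simp only [map_pow, hψa, ← pow_mul, Finset.prod_pow_eq_pow_sum, PowerSeries.coeff_X_pow]
  rw [finsum_eq_single _ (Finsupp.equivFunOnFinite.symm b)] at h2
  · rw [h3, if_pos (by simp [hm])] at h2
    exact hb (by simpa using h2)
  · intro d hd
    rw [h3]
    split_ifs with h
    · by_cases hc : MvPowerSeries.coeff d f = 0
      · simp [hc]
      · have := hmin (Finsupp.equivFunOnFinite d) (by simpa using hc) (by
          intro h'; apply hd; rw [← h']; simp)
        simp only [Finsupp.equivFunOnFinite_apply] at this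
        omega
    · simp
end
section
variable {k : Type*} [Field k]

instance isDomain_mvPowerSeries_fin (n : ℕ) : IsDomain (MvPowerSeries (Fin n) k) :=
  NoZeroDivisors.to_isDomain _

open Polynomial in
theorem exists_weierstrass (n : ℕ) (f : MvPowerSeries (Fin (n+1)) k) (hf : f ≠ 0) :
    ∃ (e : MvPowerSeries (Fin (n+1)) k ≃+* PowerSeries (MvPowerSeries (Fin n) k))
      (g : (MvPowerSeries (Fin n) k)[X]) (_ : g.Monic)
      (E : ((MvPowerSeries (Fin n) k)[X] ⧸ Ideal.span {g}) ≃ₐ[MvPowerSeries (Fin n) k]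
        (PowerSeries (MvPowerSeries (Fin n) k) ⧸ Ideal.span {e f})),
      (∃ u, IsUnit u ∧ e f = (g : PowerSeries (MvPowerSeries (Fin n) k)) * u) ∧
      (∀ p : (MvPowerSeries (Fin n) k)[X], E (Ideal.Quotient.mk _ p) =
        Ideal.Quotient.mk _ (p : PowerSeries (MvPowerSeries (Fin n) k))) := by
  obtain ⟨e, he⟩ := exists_equiv_regular n f hf
  obtain ⟨g, u, H⟩ := PowerSeries.exists_isWeierstrassFactorization he
  refine ⟨e, g, H.isDistinguishedAt.monic, H.algEquivQuotient, ⟨u, H.isUnit, H.eq_mul⟩, ?_⟩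
  intro p
  simp

theorem exists_finite_flat (n : ℕ) (f : MvPowerSeries (Fin (n+1)) k) (hf : f ≠ 0) :
    ∃ φ : MvPowerSeries (Fin n) k →+* MvPowerSeries (Fin (n+1)) k,
      ((Ideal.Quotient.mk (Ideal.span {f})).comp φ).Finite ∧
      ((Ideal.Quotient.mk (Ideal.span {f})).comp φ).Flat := by
  obtain ⟨e, g, hg, E, -, -⟩ := exists_weierstrass n f hf
  let E' : (MvPowerSeries (Fin (n+1)) k ⧸ Ideal.span {f}) ≃+*
      (PowerSeries (MvPowerSeries (Fin n) k) ⧸ Ideal.span {e f}) :=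
    Ideal.quotientEquiv _ _ e (by rw [Ideal.map_span]; simp)
  have hfin : Module.Finite (MvPowerSeries (Fin n) k)
      (Polynomial (MvPowerSeries (Fin n) k) ⧸ Ideal.span {g}) := hg.finite_quotient
  have hfree : Module.Free (MvPowerSeries (Fin n) k)
      (Polynomial (MvPowerSeries (Fin n) k) ⧸ Ideal.span {g}) := hg.free_quotient
  have h1 := Module.Finite.equiv E.toLinearEquiv
  have h2 := Module.Free.of_equiv E.toLinearEquiv
  have h3 : Module.Flat (MvPowerSeries (Fin n) k) 
    (PowerSeries (MvPowerSeries (Fin n) k) ⧸ Ideal.span {e f}) := inferInstance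
  let φ : MvPowerSeries (Fin n) k →+* MvPowerSeries (Fin (n+1)) k :=
    e.symm.toRingHom.comp PowerSeries.C
  have hcomp : (Ideal.Quotient.mk (Ideal.span {f})).comp φ =
      E'.symm.toRingHom.comp (algebraMap (MvPowerSeries (Fin n) k)
        (PowerSeries (MvPowerSeries (Fin n) k) ⧸ Ideal.span {e f})) := by
    ext x
    apply E'.injective
    change _ = E' (E'.symm _)
    rw [E'.apply_symm_apply]
    simp [E', φ]
    rfl
  refine ⟨φ, ?_, ?_⟩
  · rw [hcomp]
    exact (RingHom.Finite.of_surjective _ E'.symm.surjective).comp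
      ((RingHom.finite_algebraMap).2 h1)
  · rw [hcomp]
    exact RingHom.Flat.comp ((RingHom.flat_algebraMap_iff).2 h3)
      (RingHom.Flat.of_bijective E'.symm.bijective)

theorem ufd_mvPowerSeries (n : ℕ) : UniqueFactorizationMonoid (MvPowerSeries (Fin n) k) := by
  induction n with
  | zero =>
    exact (MulEquiv.uniqueFactorizationMonoid
      (MvPowerSeries.isEmptyEquiv (Fin 0) k).symm.toMulEquiv inferInstance)
  | succ n ih =>
    refine UniqueFactorizationMonoid.iff_exists_prime_mem_of_isPrime.mpr (fun P hP0 hP ↦ ?_)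
    obtain ⟨f, hfP, hf⟩ := Submodule.exists_mem_ne_zero_of_ne_bot hP0
    obtain ⟨e, g, hg, E, ⟨u, hu, hfg⟩, hE⟩ := exists_weierstrass n f hf
    let ι : Polynomial (MvPowerSeries (Fin n) k) →+* MvPowerSeries (Fin (n+1)) k :=
      e.symm.toRingHom.comp Polynomial.coeToPowerSeries.ringHom
    have hι : ∀ p, e (ι p) = (p : PowerSeries (MvPowerSeries (Fin n) k)) := by
      intro p; simp [ι]
    have hfg' : f = ι g * e.symm u := by
      apply e.injective; rw [map_mul, hι, hfg]; simp
    have hgP : g ∈ P.comap ι := by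
      rw [hfg'] at hfP
      rcases hP.mem_or_mem hfP with h | h
      · exact h
      · exact (hP.ne_top (Ideal.eq_top_of_isUnit_mem _ h (hu.map e.symm))).elim
    have := hP.comap ι
    obtain ⟨h, hhP, hh⟩ : ∃ h ∈ P.comap ι, Prime h ∧ h ∣ g := by
      obtain ⟨s, hs, hsg⟩ := UniqueFactorizationMonoid.exists_prime_factors g hg.ne_zero
      have : s.prod ∈ P.comap ι := by
        obtain ⟨v, hv⟩ := hsg
        rw [← hv] at hgP
        rcases this.mem_or_mem hgP with h | h
        · exact h
        · exact (this.ne_top (Ideal.eq_top_of_isUnit_mem _ h v.isUnit)).elim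
      obtain ⟨h, hhs, hh⟩ := (Ideal.IsPrime.multiset_prod_mem_iff_exists_mem ‹_› s).1 this
      exact ⟨h, hh, hs h hhs, (Multiset.dvd_prod hhs).trans hsg.dvd⟩
    refine ⟨ι h, hhP, ?_⟩
    let π : Polynomial (MvPowerSeries (Fin n) k) →+*
        (PowerSeries (MvPowerSeries (Fin n) k) ⧸ Ideal.span {e f}) :=
      E.toRingEquiv.toRingHom.comp (Ideal.Quotient.mk _)
    have hπs : Function.Surjective π := E.surjective.comp Ideal.Quotient.mk_surjective
    have hπk : RingHom.ker π = Ideal.span {g} := by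
      ext x
      rw [RingHom.mem_ker, ← Ideal.Quotient.eq_zero_iff_mem]
      exact map_eq_zero_iff E E.injective
    have hpr : (Ideal.span {h}).IsPrime := (Ideal.span_singleton_prime hh.1.ne_zero).2 hh.1
    have hpr2 : ((Ideal.span {h}).map π).IsPrime :=
      Ideal.map_isPrime_of_surjective hπs (by
        rw [hπk, Ideal.span_singleton_le_span_singleton]; exact hh.2)
    have hπι : ∀ p, π p = Ideal.Quotient.mk _ (e (ι p)) := by
      intro p; rw [hι]; exact hE p
    have hpr3 := hpr2.comap ((Ideal.Quotient.mk (Ideal.span {e f})).comp e.toRingHom)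
    have heq : ((Ideal.span {h}).map π).comap
        ((Ideal.Quotient.mk (Ideal.span {e f})).comp e.toRingHom) = Ideal.span {ι h} := by
      have hdvd : ι h ∣ f := by
        rw [hfg']; exact (map_dvd ι hh.2).mul_right _
      ext x
      rw [Ideal.mem_comap, Ideal.map_span, Set.image_singleton, Ideal.mem_span_singleton, 
        Ideal.mem_span_singleton, hπι]
      constructor
      · rintro ⟨y, hy⟩
        obtain ⟨y, rfl⟩ := Ideal.Quotient.mk_surjective y
        rw [← map_mul, RingHom.comp_apply, Ideal.Quotient.eq, Ideal.mem_span_singleton] at hy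
        obtain ⟨z, hz⟩ := hy
        have : x = ι h * e.symm y + f * e.symm z := by
          apply e.injective
          simp only [map_add, map_mul, e.apply_symm_apply]
          rw [← hz]
          simp
        rw [this]
        exact dvd_add (dvd_mul_right _ _) (hdvd.mul_right _)
      · intro hx
        exact map_dvd ((Ideal.Quotient.mk (Ideal.span {e f})).comp e.toRingHom) hx
    rw [heq] at hpr3
    refine (Ideal.span_singleton_prime ?_).1 hpr3
    intro h0
    have h1 : ((h : Polynomial (MvPowerSeries (Fin n) k)) : 
      PowerSeries (MvPowerSeries (Fin n) k)) = 0 := by rw [← hι, h0, map_zero]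
    exact hh.1.ne_zero (by simpa using h1)

theorem normal_mvPowerSeries (n : ℕ) : IsIntegrallyClosed (MvPowerSeries (Fin n) k) := by
  have := ufd_mvPowerSeries (k := k) n
  infer_instance
end
section
theorem height_eq_of_integral_of_goingDown {A B : Type*} [CommRing A] [CommRing B] [Algebra A B]
    [IsNoetherianRing A] [IsNoetherianRing B] [Algebra.IsIntegral A B] [Algebra.HasGoingDown A B]
    (p : Ideal A) [p.IsPrime] (P : Ideal B) [hPp : P.IsPrime] [hP : P.LiesOver p] :
    P.height = p.height := by
  rw [Ideal.height_eq_height_add_of_liesOver_of_hasGoingDown p P]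
  have hle : p.map (algebraMap A B) ≤ P := by
    rw [Ideal.map_le_iff_le_comap, hP.over]
  have hpr : (P.map (Ideal.Quotient.mk <| p.map (algebraMap A B))).IsPrime :=
    Ideal.map_isPrime_of_surjective Ideal.Quotient.mk_surjective (by rwa [Ideal.mk_ker])
  have hcm : (P.map (Ideal.Quotient.mk <| p.map (algebraMap A B))).comap
      (Ideal.Quotient.mk _) = P := by
    rw [Ideal.comap_map_of_surjective _ Ideal.Quotient.mk_surjective]
    apply le_antisymm
    · refine sup_le le_rfl ?_
      rw [← RingHom.ker_eq_comap_bot, Ideal.mk_ker]; exact hle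
    · exact le_sup_left
  have : (P.map (Ideal.Quotient.mk <| p.map (algebraMap A B))).height = 0 := by
    rw [Ideal.height_eq_zero_iff]
    refine ⟨⟨hpr, bot_le⟩, ?_⟩
    rintro J ⟨hJ, -⟩ hJle
    have hJ' := hJ.comap (Ideal.Quotient.mk (p.map (algebraMap A B)))
    have hJP : J.comap (Ideal.Quotient.mk (p.map (algebraMap A B))) ≤ P := by
      rw [← hcm]; exact Ideal.comap_mono hJle
    have hpJ : p.map (algebraMap A B) ≤ J.comap (Ideal.Quotient.mk _) := by
      intro x hx
      rw [Ideal.mem_comap, Ideal.Quotient.eq_zero_iff_mem.2 hx]; exact zero_mem _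
    rw [Ideal.map_le_iff_le_comap]
    by_contra hn
    obtain ⟨x, hxP, hxJ⟩ := Set.not_subset.1 hn
    have hlt := Ideal.comap_lt_comap_of_integral_mem_sdiff (R := A) hJP ⟨hxP, hxJ⟩
      (Algebra.IsIntegral.isIntegral x)
    refine hlt.not_ge ?_
    have : P.comap (algebraMap A B) = p := hP.over.symm
    rw [this]
    exact Ideal.map_le_iff_le_comap.1 hpJ
  rw [this, add_zero]

theorem height_quotient_add_one_le {R : Type*} [CommRing R] [IsDomain R] [IsNoetherianRing R]
    (f : R) (hf : f ≠ 0)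
    (Q : Ideal R) [hQ : Q.IsPrime] (Q' : Ideal (R ⧸ Ideal.span {f})) [hQ' : Q'.IsPrime]
    (h : Q'.comap (Ideal.Quotient.mk _) = Q) : Q'.height + 1 ≤ Q.height := by
  obtain ⟨l, hl, hlen⟩ := Q'.exists_ltSeries_length_eq_height
  have hsm : StrictMono (PrimeSpectrum.comap (Ideal.Quotient.mk (Ideal.span {f}))) := by
    intro a b hab
    refine lt_of_le_of_ne (Ideal.comap_mono hab.le) ?_
    intro heq
    apply hab.ne
    apply PrimeSpectrum.comap_injective_of_surjective _ Ideal.Quotient.mk_surjective heq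
  let l' := l.map _ hsm
  have hbot : (⊥ : PrimeSpectrum R) < l'.head := by
    refine lt_of_le_of_ne bot_le ?_
    intro h0
    have : f ∈ l'.head.asIdeal := by
      simp only [l', LTSeries.head_map, PrimeSpectrum.comap_asIdeal, Ideal.mem_comap]
      rw [Ideal.Quotient.eq_zero_iff_mem.2 (Ideal.mem_span_singleton_self f)]
      exact zero_mem _
    rw [← h0] at this
    exact hf (by simpa using this)
  have hlast : (l'.cons ⊥ hbot).last = ⟨Q, hQ⟩ := by
    rw [RelSeries.last_cons]
    ext1
    simp only [l', LTSeries.last_map, PrimeSpectrum.comap_asIdeal, hl]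
    exact h
  have := Order.length_le_height (p := l'.cons ⊥ hbot) (x := ⟨Q, hQ⟩) hlast.le
  rw [← PrimeSpectrum.height_eq_orderHeight] at this
  rw [← hlen]
  simpa [l'] using this

theorem finite_inj_comp {R A D : Type*} [CommRing R] [CommRing A] [CommRing D] (ψ : A →+* D)
    (hψ : ψ.Finite) (q : Ideal A) (hq : RingHom.ker ψ = q) (φ : R →+* A ⧸ q)
    (hφ : φ.Finite) (hi : Function.Injective φ) :
    ∃ χ : R →+* D, χ.Finite ∧ Function.Injective χ := by
  subst hq
  refine ⟨(RingHom.kerLift ψ).comp φ, RingHom.Finite.comp ?_ hφ,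
    (RingHom.kerLift_injective ψ).comp hi⟩
  apply RingHom.Finite.of_comp_finite (f := Ideal.Quotient.mk (RingHom.ker ψ))
  have h : (RingHom.kerLift ψ).comp (Ideal.Quotient.mk (RingHom.ker ψ)) = ψ :=
    RingHom.ext fun x => rfl
  rw [h]
  exact hψ

variable {k : Type*} [Field k]

theorem exists_noether (n : ℕ) (Q : Ideal (MvPowerSeries (Fin n) k)) (hQ : Q.IsPrime) :
    ∃ (d : ℕ) (φ : MvPowerSeries (Fin d) k →+* MvPowerSeries (Fin n) k ⧸ Q),
      φ.Finite ∧ Function.Injective φ ∧ Q.height + d = n := by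
  by_cases hb : Q = ⊥
  · subst hb
    refine ⟨n, Ideal.Quotient.mk _, RingHom.Finite.of_surjective _ Ideal.Quotient.mk_surjective,
      ?_, ?_⟩
    · rw [RingHom.injective_iff_ker_eq_bot, Ideal.mk_ker]
    · rw [Ideal.height_bot, zero_add]
  induction n with
  | zero =>
    exfalso
    apply hb
    rw [eq_bot_iff]
    have := IsLocalRing.le_maximalIdeal hQ.ne_top
    rw [maximalIdeal_eq_span] at this
    simpa using this
  | succ n ih =>
    obtain ⟨f, hfQ, hf⟩ := Submodule.exists_mem_ne_zero_of_ne_bot hb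
    obtain ⟨φ0, hfin, hflat⟩ := exists_finite_flat n f hf
    letI : Algebra (MvPowerSeries (Fin n) k) (MvPowerSeries (Fin (n+1)) k ⧸ Ideal.span {f}) :=
      ((Ideal.Quotient.mk (Ideal.span {f})).comp φ0).toAlgebra
    have hfin' : Module.Finite (MvPowerSeries (Fin n) k)
      (MvPowerSeries (Fin (n+1)) k ⧸ Ideal.span {f}) := hfin
    have hflat' : Module.Flat (MvPowerSeries (Fin n) k)
      (MvPowerSeries (Fin (n+1)) k ⧸ Ideal.span {f}) := hflat
    have hle : Ideal.span {f} ≤ Q := (Ideal.span_singleton_le_iff_mem _).2 hfQ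
    let Q' := Q.map (Ideal.Quotient.mk (Ideal.span {f}))
    have hQ' : Q'.IsPrime :=
      Ideal.map_isPrime_of_surjective Ideal.Quotient.mk_surjective (by rwa [Ideal.mk_ker])
    have hcm : Q'.comap (Ideal.Quotient.mk _) = Q := by
      rw [Ideal.comap_map_of_surjective _ Ideal.Quotient.mk_surjective]
      apply le_antisymm
      · refine sup_le le_rfl ?_
        rw [← RingHom.ker_eq_comap_bot, Ideal.mk_ker]; exact hle
      · exact le_sup_left
    let q : Ideal (MvPowerSeries (Fin n) k) := Q'.under _
    have hqe : q = Q.comap φ0 := by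
      rw [← hcm]; rfl
    have hq : q.IsPrime := inferInstance
    have h1 : Q'.height = q.height := height_eq_of_integral_of_goingDown q Q'
    have h2 : Q'.height + 1 ≤ Q.height := height_quotient_add_one_le f hf Q Q' hcm
    have h3 : Q.height ≤ Q'.height + 1 := Ideal.height_le_height_add_one_of_mem hfQ
    have h4 : Q.height = q.height + 1 := by rw [← h1]; exact le_antisymm h3 h2
    have hψ : ((Ideal.Quotient.mk Q).comp φ0).Finite := by
      have : (Ideal.Quotient.mk Q).comp φ0 =
        (Ideal.Quotient.factor hle).comp ((Ideal.Quotient.mk (Ideal.span {f})).comp φ0) := by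
        ext x; simp
      rw [this]
      exact (RingHom.Finite.of_surjective _ (Ideal.Quotient.factor_surjective hle)).comp hfin
    have hker : RingHom.ker ((Ideal.Quotient.mk Q).comp φ0) = q := by
      rw [hqe, ← RingHom.comap_ker, Ideal.mk_ker]
    have key : ∃ (d : ℕ) (φ : MvPowerSeries (Fin d) k →+* MvPowerSeries (Fin n) k ⧸ q),
      φ.Finite ∧ Function.Injective φ ∧ q.height + d = n := by
      by_cases hqb : q = ⊥
      · rw [hqb]
        refine ⟨n, Ideal.Quotient.mk _,
          RingHom.Finite.of_surjective _ Ideal.Quotient.mk_surjective, ?_, ?_⟩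
        · rw [RingHom.injective_iff_ker_eq_bot, Ideal.mk_ker]
        · rw [Ideal.height_bot, zero_add]
      · exact ih q hq hqb
    obtain ⟨d, φ, hφf, hφi, hd⟩ := key
    obtain ⟨χ, hχf, hχi⟩ := finite_inj_comp _ hψ q hker φ hφf hφi
    refine ⟨d, χ, hχf, hχi, ?_⟩
    rw [h4, add_right_comm, hd]; norm_cast

theorem height_maximalIdeal_mvPowerSeries (n : ℕ) :
    (IsLocalRing.maximalIdeal (MvPowerSeries (Fin n) k)).height = n := by
  obtain ⟨d, φ, hf, hi, hd⟩ := exists_noether n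
    (IsLocalRing.maximalIdeal (MvPowerSeries (Fin n) k))
    (IsLocalRing.maximalIdeal.isMaximal (MvPowerSeries (Fin n) k)).isPrime
  letI := φ.toAlgebra
  have : Module.Finite (MvPowerSeries (Fin d) k) (MvPowerSeries (Fin n) k ⧸
    IsLocalRing.maximalIdeal (MvPowerSeries (Fin n) k)) := hf
  have hfield : IsField (MvPowerSeries (Fin d) k) :=
    isField_of_isIntegral_of_isField (S := MvPowerSeries (Fin n) k ⧸
    IsLocalRing.maximalIdeal (MvPowerSeries (Fin n) k)) hi
    ((Ideal.Quotient.maximal_ideal_iff_isField_quotient _).1 inferInstance)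
  rcases Nat.eq_zero_or_pos d with rfl | hpos
  · simpa using hd
  · exfalso
    obtain ⟨y, hy⟩ := hfield.mul_inv_cancel (a := MvPowerSeries.X (⟨0, hpos⟩ : Fin d))
      (by
        intro h
        have := congrArg (MvPowerSeries.coeff (Finsupp.single (⟨0, hpos⟩ : Fin d) 1)) h
        simp at this)
    have := congrArg MvPowerSeries.constantCoeff hy
    simp at this

theorem height_maximalIdeal_of_noether (d : ℕ) (D : Type*) [CommRing D] [IsDomain D]
    [IsNoetherianRing D] [IsLocalRing D] (φ : MvPowerSeries (Fin d) k →+* D) (hf : φ.Finite)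
    (hi : Function.Injective φ) : (IsLocalRing.maximalIdeal D).height = d := by
  letI := φ.toAlgebra
  have : Module.Finite (MvPowerSeries (Fin d) k) D := hf
  have : FaithfulSMul (MvPowerSeries (Fin d) k) D := (faithfulSMul_iff_algebraMap_injective _ _).2 hi
  have := normal_mvPowerSeries (k := k) d
  have hm : ((IsLocalRing.maximalIdeal D).under (MvPowerSeries (Fin d) k)).IsMaximal :=
    Ideal.isMaximal_comap_of_isIntegral_of_isMaximal _
  have h1 := height_eq_of_integral_of_goingDown
    ((IsLocalRing.maximalIdeal D).under (MvPowerSeries (Fin d) k)) (IsLocalRing.maximalIdeal D)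
  rw [h1, IsLocalRing.eq_maximalIdeal hm, height_maximalIdeal_mvPowerSeries]
end

/-- For a field `k`, if `P < Q` are adjacent prime ideals of the power series ring
`k⟦X₁,…,Xₙ⟧ = MvPowerSeries (Fin n) k` (no prime ideal lies strictly between them), then
the height of `Q` equals the height of `P` plus one. -/
theorem height_succ_of_adjacent_primes_mvPowerSeries {k : Type*} [Field k] (n : ℕ)
    (P Q : Ideal (MvPowerSeries (Fin n) k)) (hP : P.IsPrime) (hQ : Q.IsPrime)
    (hlt : P < Q)
    (hadj : ¬ ∃ I : Ideal (MvPowerSeries (Fin n) k), I.IsPrime ∧ P < I ∧ I < Q) :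
    Order.height (⟨Q, hQ⟩ : PrimeSpectrum (MvPowerSeries (Fin n) k))
      = Order.height (⟨P, hP⟩ : PrimeSpectrum (MvPowerSeries (Fin n) k)) + 1 := by
  rw [← PrimeSpectrum.height_eq_orderHeight, ← PrimeSpectrum.height_eq_orderHeight]
  change Q.height = P.height + 1
  obtain ⟨d, φ, hφf, hφi, hd⟩ := exists_noether n P hP
  obtain ⟨e', χ', hχf', hχi', he'⟩ := exists_noether n Q hQ
  have hle := hlt.le
  let Q' := Q.map (Ideal.Quotient.mk P)
  have hQ' : Q'.IsPrime :=
    Ideal.map_isPrime_of_surjective Ideal.Quotient.mk_surjective (by rwa [Ideal.mk_ker])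
  have hcm : Q'.comap (Ideal.Quotient.mk _) = Q := by
    rw [Ideal.comap_map_of_surjective _ Ideal.Quotient.mk_surjective]
    apply le_antisymm
    · refine sup_le le_rfl ?_
      rw [← RingHom.ker_eq_comap_bot, Ideal.mk_ker]; exact hle
    · exact le_sup_left
  have hQ'1 : Q'.height = 1 := by
    apply le_antisymm
    · have : Q'.height ≤ (1 : ℕ) := by
        rw [Ideal.height_le_iff]
        intro J hJ hJQ
        have hJb : J = ⊥ := by
          by_contra hne
          apply hadj
          refine ⟨J.comap (Ideal.Quotient.mk P), hJ.comap _, ?_, ?_⟩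
          · refine lt_of_le_of_ne ?_ ?_
            · intro x hx
              rw [Ideal.mem_comap, Ideal.Quotient.eq_zero_iff_mem.2 hx]; exact zero_mem _
            · intro h
              apply hne
              rw [← Ideal.map_comap_of_surjective _ Ideal.Quotient.mk_surjective J, ← h,
                Ideal.map_quotient_self]
          · refine lt_of_le_of_ne ?_ ?_
            · rw [← hcm]; exact Ideal.comap_mono hJQ.le
            · intro h
              apply hJQ.ne
              rw [← Ideal.map_comap_of_surjective _ Ideal.Quotient.mk_surjective J, h]
        rw [hJb, Ideal.height_bot]
        norm_num
      exact_mod_cast this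
    · rw [ENat.one_le_iff_ne_zero, Ne, Ideal.height_eq_zero_iff_eq_bot]
      intro h0
      apply hlt.ne
      rw [← hcm, h0, ← RingHom.ker_eq_comap_bot, Ideal.mk_ker]
  letI := φ.toAlgebra
  have : Module.Finite (MvPowerSeries (Fin d) k) (MvPowerSeries (Fin n) k ⧸ P) := hφf
  have : FaithfulSMul (MvPowerSeries (Fin d) k) (MvPowerSeries (Fin n) k ⧸ P) :=
    (faithfulSMul_iff_algebraMap_injective _ _).2 hφi
  have := normal_mvPowerSeries (k := k) d
  let q : Ideal (MvPowerSeries (Fin d) k) := Q'.under _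
  have hq : q.IsPrime := inferInstance
  have hq1 : q.height = 1 := by
    rw [← hQ'1]; exact (height_eq_of_integral_of_goingDown q Q').symm
  obtain ⟨e, θ, hθf, hθi, he⟩ := exists_noether d q hq
  have hψ : ((Ideal.Quotient.factor hle).comp φ).Finite :=
    (RingHom.Finite.of_surjective _ (Ideal.Quotient.factor_surjective hle)).comp hφf
  have hker : RingHom.ker ((Ideal.Quotient.factor hle).comp φ) = q := by
    rw [← RingHom.comap_ker, Ideal.Quotient.factor_ker]
    rfl
  obtain ⟨χ, hχf, hχi⟩ := finite_inj_comp _ hψ q hker θ hθf hθi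
  have : IsLocalRing (MvPowerSeries (Fin n) k ⧸ Q) :=
    IsLocalRing.of_surjective' (Ideal.Quotient.mk Q) Ideal.Quotient.mk_surjective
  have h1 := height_maximalIdeal_of_noether e _ χ hχf hχi
  have h2 := height_maximalIdeal_of_noether e' _ χ' hχf' hχi'
  have h3 : e = e' := by
    have := h1.symm.trans h2
    exact_mod_cast this
  subst h3
  rw [hq1] at he
  have hed : 1 + e = d := by exact_mod_cast he
  subst hed
  have h5 : Q.height + e = (P.height + 1) + e := by
    rw [he', ← hd]; push_cast; ring
  exact WithTop.add_right_cancel (ENat.coe_ne_top e) h5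
end
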